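/- Let P(t) = c·t^r with c ∈ ℂ*, r ≥ 1, and suppose d = gcd(r, m) > 1. Then in R_m(P) = ℂ[t,t⁻¹,u]/(u^m - P(t)) the element x = 1 - c^{-1/d}·t^{-r/d}·u^{m/d} (for a fixed d-th root c^{1/d}) is annihilated by the derivation Δ = P'(t)∂/∂u + m·u^{m-1}∂/∂t, and x·R_m(P) is a nonzero proper Δ-stable ideal of R_m(P). -/

import Mathlib

open Polynomial

set_option maxHeartbeats 1000000
set_option synthInstance.maxHeartbeats 400000

/-- `R_m(P) = ℂ[t,t⁻¹][u]/(u^m - P(t))` for a Laurent polynomial `P`. -/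
abbrev RmL (m : ℕ) (Q : LaurentPolynomial ℂ) : Type :=
  Polynomial (LaurentPolynomial ℂ) ⧸ Ideal.span {(X : Polynomial (LaurentPolynomial ℂ)) ^ m - C Q}

section Derivation

variable {A : Type*} [CommRing A] [Algebra ℂ A] (D : Derivation ℂ A A)

theorem derivation_one_sub_mul_pow_eq_zero {t u a γ : A} {b : ℂ} {m n k r : ℕ}
    (ht : IsUnit t) (hu : IsUnit u) (hm : m ≠ 0) (hn : n ≠ 0) (hk : k ≠ 0) (hr : r ≠ 0)
    (hkm : k * m = n * r) (hum : u ^ m = γ * t ^ r) (hat : a * t ^ k = algebraMap ℂ A b)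
    (hDt : D t = m * u ^ (m - 1)) (hDu : D u = γ * (r * t ^ (r - 1))) :
    D (1 - a * u ^ n) = 0 := by
  have hDa : D a * t ^ k + a * (k * t ^ (k - 1) * (m * u ^ (m - 1))) = 0 := by
    have := congrArg D hat
    rw [D.map_algebraMap, D.leibniz, D.leibniz_pow, hDt] at this
    simp only [smul_eq_mul, nsmul_eq_mul] at this
    linear_combination this
  have hum' : u ^ (m - 1) * u = u ^ m := pow_sub_one_mul hm _
  have hun : u ^ (n - 1) * u = u ^ n := pow_sub_one_mul hn _
  have htk : t ^ (k - 1) * t = t ^ k := pow_sub_one_mul hk _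
  have htr : t ^ (r - 1) * t = t ^ r := pow_sub_one_mul hr _
  have hkm' : (k : A) * m = n * r := by exact_mod_cast congrArg (Nat.cast : ℕ → A) hkm
  rw [map_sub, D.map_one_eq_zero, D.leibniz, D.leibniz_pow, zero_sub, neg_eq_zero, hDu]
  simp only [smul_eq_mul, nsmul_eq_mul]
  apply (((ht.pow k).mul ht).mul hu).mul_left_cancel
  linear_combination (u ^ n * u * t) * hDa + (a * n * γ * r * t ^ (r - 1) * t ^ k * t) * hun
    + (a * n * γ * r * t ^ k * u ^ n) * htr - (a * n * r * t ^ k * u ^ n) * hum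
    - (u ^ n * u * a * k * m * u ^ (m - 1)) * htk - (u ^ n * a * k * m * t ^ k) * hum'
    - (a * t ^ k * u ^ n * u ^ m) * hkm'

theorem derivation_mem_span_singleton {x : A} (hx : D x = 0) {y : A} (hy : y ∈ Ideal.span {x}) :
    D y ∈ Ideal.span {x} := by
  obtain ⟨z, rfl⟩ := Ideal.mem_span_singleton.mp hy
  rw [D.leibniz, hx, smul_zero, add_zero, smul_eq_mul]
  exact Ideal.mul_mem_right _ _ (Ideal.mem_span_singleton_self _)

end Derivation

theorem span_singleton_ne_top_of_map_eq_zero {A B : Type*} [CommRing A] [CommRing B] [Nontrivial B]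
    (f : A →+* B) {x : A} (hx : f x = 0) : Ideal.span {x} ≠ ⊤ := by
  rw [Ne, Ideal.span_singleton_eq_top]
  exact fun h => (h.map f).ne_zero hx

namespace RmL

variable {m : ℕ} {Q : LaurentPolynomial ℂ}

/-- The projection `ℂ[t,t⁻¹][u] → R_m(Q)`. -/
noncomputable abbrev mk (m : ℕ) (Q : LaurentPolynomial ℂ) :
    Polynomial (LaurentPolynomial ℂ) →+* RmL m Q :=
  Ideal.Quotient.mk _

/-- The class of the coordinate `t` in `R_m(Q)`. -/
noncomputable abbrev t (m : ℕ) (Q : LaurentPolynomial ℂ) : RmL m Q :=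
  mk m Q (C (LaurentPolynomial.T 1))

/-- The class of the coordinate `u` in `R_m(Q)`. -/
noncomputable abbrev u (m : ℕ) (Q : LaurentPolynomial ℂ) : RmL m Q :=
  mk m Q X

/-- The inclusion of the constants in `R_m(Q)`. -/
noncomputable abbrev const (m : ℕ) (Q : LaurentPolynomial ℂ) : ℂ →+* RmL m Q :=
  algebraMap ℂ (RmL m Q)

theorem u_pow : u m Q ^ m = mk m Q (C Q) := by
  rw [← map_pow]
  exact Ideal.Quotient.eq.mpr (Ideal.mem_span_singleton_self _)

theorem mk_C_C_mul (a : ℂ) (q : LaurentPolynomial ℂ) :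
    mk m Q (C (LaurentPolynomial.C a * q)) = const m Q a * mk m Q (C q) := by
  rw [map_mul, map_mul]
  rfl

theorem const_mul_natCast (a : ℂ) (n : ℕ) : const m Q (a * n) = const m Q a * (n : RmL m Q) := by
  rw [map_mul, map_natCast]

theorem mk_C_T_natCast (n : ℕ) : mk m Q (C (LaurentPolynomial.T (n : ℤ))) = t m Q ^ n := by
  rw [← map_pow, ← map_pow, LaurentPolynomial.T_pow, mul_one]

theorem mk_C_T_add (a b : ℤ) :
    mk m Q (C (LaurentPolynomial.T (a + b))) =
      mk m Q (C (LaurentPolynomial.T a)) * mk m Q (C (LaurentPolynomial.T b)) := by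
  rw [LaurentPolynomial.T_add, map_mul, map_mul]

theorem isUnit_t : IsUnit (t m Q) :=
  ((LaurentPolynomial.isUnit_T 1).map C).map (mk m Q)

/-- The algebra homomorphism out of `R_m(Q)` with prescribed images of `t` and `u`. -/
noncomputable def lift {B : Type*} [CommRing B] [Algebra ℂ B] (T : Bˣ) (U : B)
    (h : U ^ m = LaurentPolynomial.eval₂ (algebraMap ℂ B) T Q) : RmL m Q →ₐ[ℂ] B where
  __ := Ideal.Quotient.lift (Ideal.span {(X : Polynomial (LaurentPolynomial ℂ)) ^ m - C Q})
    (Polynomial.eval₂RingHom (LaurentPolynomial.eval₂ (algebraMap ℂ B) T) U) (by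
      intro a ha
      obtain ⟨b, rfl⟩ := Ideal.mem_span_singleton.mp ha
      simp [h])
  commutes' a := by
    change Ideal.Quotient.lift _ _ _ (Ideal.Quotient.mk _ (C (LaurentPolynomial.C a))) = _
    simp

section Lift

variable {B : Type*} [CommRing B] [Algebra ℂ B] (T : Bˣ) (U : B)
  (h : U ^ m = LaurentPolynomial.eval₂ (algebraMap ℂ B) T Q)

theorem lift_mk (p : Polynomial (LaurentPolynomial ℂ)) :
    lift T U h (mk m Q p) = p.eval₂ (LaurentPolynomial.eval₂ (algebraMap ℂ B) T) U :=
  rfl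

theorem lift_mk_C_T (n : ℤ) :
    lift T U h (mk m Q (C (LaurentPolynomial.T n))) = (T ^ n).val := by
  simp [lift_mk]

theorem lift_t : lift T U h (t m Q) = T := by
  simp [lift_mk_C_T]

theorem lift_u : lift T U h (u m Q) = U := by
  simp [lift_mk]

end Lift

theorem algHom_ext {B : Type*} [CommRing B] [Algebra ℂ B] {f g : RmL m Q →ₐ[ℂ] B}
    (ht : f (t m Q) = g (t m Q)) (hu : f (u m Q) = g (u m Q)) : f = g := by
  apply AlgHom.coe_ringHom_injective
  refine Ideal.Quotient.ringHom_ext (Polynomial.ringHom_ext' ?_ hu)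
  refine IsLocalization.ringHom_ext (Submonoid.powers (X : ℂ[X])) (Polynomial.ringHom_ext ?_ ?_)
  · intro a
    have : f (mk m Q (C (LaurentPolynomial.C a))) = g (mk m Q (C (LaurentPolynomial.C a))) :=
      (f.commutes a).trans (g.commutes a).symm
    simpa [LaurentPolynomial.algebraMap_eq_toLaurent] using this
  · simpa [LaurentPolynomial.algebraMap_eq_toLaurent] using ht

section Monomial

variable {r : ℕ} {c : ℂ}

local notation "M" => LaurentPolynomial.C c * LaurentPolynomial.T (r : ℤ)

theorem u_pow_monomial : u m M ^ m = const m M c * t m M ^ r := by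
  rw [u_pow, mk_C_C_mul, mk_C_T_natCast]

theorem isUnit_u (hm : m ≠ 0) (hc : c ≠ 0) : IsUnit (u m M) := by
  rw [← isUnit_pow_iff hm, u_pow_monomial]
  exact ((IsUnit.mk0 c hc).map (const m M)).mul (isUnit_t.pow r)

/-- A first-order deformation of an `A`-point of `R_m(c t^r)`: an algebra homomorphism into `A`
together with a derivation along it. -/
theorem exists_hom_with_derivation {A : Type*} [CommRing A] [Algebra ℂ A] (t₀ u₀ dt du : A)
    (ht : IsUnit t₀) (h : u₀ ^ m = algebraMap ℂ A c * t₀ ^ r)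
    (hd : m * u₀ ^ (m - 1) * du = algebraMap ℂ A c * (r * t₀ ^ (r - 1) * dt)) :
    ∃ (g : RmL m M →ₐ[ℂ] A) (δ : RmL m M →ₗ[ℂ] A),
      (∀ a b, δ (a * b) = g a * δ b + g b * δ a) ∧
      g (t m M) = t₀ ∧ g (u m M) = u₀ ∧ δ (t m M) = dt ∧ δ (u m M) = du := by
  have hT : IsUnit (TrivSqZeroExt.inl t₀ + TrivSqZeroExt.inr dt : TrivSqZeroExt A A) := by
    rw [TrivSqZeroExt.isUnit_iff_isUnit_fst]
    simpa using ht
  have hU : (TrivSqZeroExt.inl u₀ + TrivSqZeroExt.inr du : TrivSqZeroExt A A) ^ m =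
      LaurentPolynomial.eval₂ (algebraMap ℂ (TrivSqZeroExt A A)) hT.unit M := by
    rw [LaurentPolynomial.eval₂_C_mul_T_n, IsUnit.unit_spec]
    ext
    · simp [TrivSqZeroExt.algebraMap_eq_inl', h]
    · rw [TrivSqZeroExt.algebraMap_eq_inl', TrivSqZeroExt.snd_pow, TrivSqZeroExt.snd_mul,
        TrivSqZeroExt.snd_pow]
      simpa only [TrivSqZeroExt.fst_inl, TrivSqZeroExt.snd_inl, TrivSqZeroExt.fst_add,
        TrivSqZeroExt.snd_add, TrivSqZeroExt.fst_inr, TrivSqZeroExt.snd_inr, add_zero, zero_add,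
        smul_zero, smul_eq_mul, nsmul_eq_mul, mul_assoc, Nat.pred_eq_sub_one] using hd
  refine ⟨(TrivSqZeroExt.fstHom ℂ A A).comp (lift hT.unit _ hU),
    (TrivSqZeroExt.sndHom A A).restrictScalars ℂ ∘ₗ (lift hT.unit _ hU).toLinearMap,
    fun a b => ?_, ?_, ?_, ?_, ?_⟩
  · change (lift hT.unit _ hU (a * b)).snd = _
    rw [map_mul, TrivSqZeroExt.snd_mul, op_smul_eq_smul]
    rfl
  all_goals simp [lift_t, lift_u]

theorem exists_derivation :
    ∃ D : Derivation ℂ (RmL m M) (RmL m M),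
      D (t m M) = (m : RmL m M) * u m M ^ (m - 1) ∧
      D (u m M) = const m M c * ((r : RmL m M) * t m M ^ (r - 1)) := by
  obtain ⟨g, δ, hδ, hgt, hgu, hδt, hδu⟩ := exists_hom_with_derivation (m := m) (r := r) (c := c)
    (t m M) (u m M) ((m : RmL m M) * u m M ^ (m - 1))
    (const m M c * ((r : RmL m M) * t m M ^ (r - 1))) isUnit_t u_pow_monomial (by ring)
  have hg : g = AlgHom.id ℂ (RmL m M) := by
    apply algHom_ext (B := RmL m M) (f := g) (g := AlgHom.id ℂ (RmL m M))
    · exact hgt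
    · exact hgu
  refine ⟨Derivation.mk' δ fun a b => ?_, hδt, hδu⟩
  rw [hδ, hg]
  rfl

theorem exists_eval {s : ℂ} (hs : s ^ m = c) :
    ∃ f : RmL m M →ₐ[ℂ] ℂ,
      (∀ n : ℤ, f (mk m M (C (LaurentPolynomial.T n))) = 1) ∧ f (u m M) = s := by
  refine ⟨lift 1 s (by simp [hs]), fun n => ?_, lift_u _ _ _⟩
  rw [lift_mk_C_T]
  simp

end Monomial

end RmL

/-- For `P = c t^r` with `d = gcd(r,m) > 1`, the element
`x = 1 - c^{-1/d} t^{-r/d} u^{m/d}` of `R_m(P)` is killed by the derivation `Δ`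
with `Δ(t) = m u^{m-1}`, `Δ(u) = P'(t)`, and `x·R_m(P)` is a nonzero proper
`Δ`-stable ideal. -/
theorem stmt_4 (m r : ℕ) (hm : 2 ≤ m) (hr : 1 ≤ r) (c c' : ℂ) (hc : c ≠ 0)
    (d : ℕ) (hd : d = Nat.gcd r m) (hd1 : 1 < d) (hc' : c' ^ d = c) :
    ∃ D : Derivation ℂ (RmL m (LaurentPolynomial.C c * LaurentPolynomial.T r))
        (RmL m (LaurentPolynomial.C c * LaurentPolynomial.T r)),
      ∃ x : RmL m (LaurentPolynomial.C c * LaurentPolynomial.T r),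
      x = 1 - Ideal.Quotient.mk _ (C (LaurentPolynomial.C c'⁻¹ *
            LaurentPolynomial.T (-((r / d : ℕ) : ℤ)))) *
          (Ideal.Quotient.mk _ X) ^ (m / d) ∧
      D (Ideal.Quotient.mk _ (C (LaurentPolynomial.T 1))) =
        (m : RmL m (LaurentPolynomial.C c * LaurentPolynomial.T r)) *
          (Ideal.Quotient.mk _ X) ^ (m - 1) ∧
      D (Ideal.Quotient.mk _ X) =
        Ideal.Quotient.mk _ (C (LaurentPolynomial.C (c * r) *
          LaurentPolynomial.T ((r : ℤ) - 1))) ∧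
      D x = 0 ∧
      Ideal.span {x} ≠ ⊥ ∧
      Ideal.span {x} ≠ ⊤ ∧
      ∀ y ∈ Ideal.span {x}, D y ∈ Ideal.span {x} := by
  have hd0 : d ≠ 0 := by omega
  obtain ⟨k, hk⟩ : d ∣ r := hd ▸ Nat.gcd_dvd_left r m
  obtain ⟨n, hn⟩ : d ∣ m := hd ▸ Nat.gcd_dvd_right r m
  have hrd : r / d = k := by rw [hk, Nat.mul_div_cancel_left _ (by omega)]
  have hmd : m / d = n := by rw [hn, Nat.mul_div_cancel_left _ (by omega)]
  have hkm : k * m = n * r := by rw [hn, hk]; ring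
  have hn0 : n ≠ 0 := by rintro rfl; omega
  have hk0 : k ≠ 0 := by rintro rfl; omega
  have hc'0 : c' ≠ 0 := by rintro rfl; exact hc (by rw [← hc', zero_pow hd0])
  obtain ⟨D, hDt, hDu⟩ := RmL.exists_derivation (m := m) (r := r) (c := c)
  rw [hrd, hmd]
  have hfx (s : ℂ) (hs : s ^ m = c) :
      ∃ f : RmL m (LaurentPolynomial.C c * LaurentPolynomial.T r) →ₐ[ℂ] ℂ,
        f (1 - RmL.mk m _ (C (LaurentPolynomial.C c'⁻¹ * LaurentPolynomial.T (-(k : ℤ)))) *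
          RmL.u m _ ^ n) = 1 - c'⁻¹ * s ^ n := by
    obtain ⟨f, hft, hfu⟩ := RmL.exists_eval (r := r) hs
    refine ⟨f, ?_⟩
    rw [map_sub, map_one, map_mul, map_pow, hfu, RmL.mk_C_C_mul, map_mul, hft, AlgHom.commutes,
      mul_one]
    rfl
  have hat : RmL.mk m (LaurentPolynomial.C c * LaurentPolynomial.T r)
      (C (LaurentPolynomial.C c'⁻¹ * LaurentPolynomial.T (-(k : ℤ)))) * RmL.t m _ ^ k =
        RmL.const m _ c'⁻¹ := by
    rw [RmL.mk_C_C_mul, mul_assoc, ← RmL.mk_C_T_natCast, ← RmL.mk_C_T_add, neg_add_cancel,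
      LaurentPolynomial.T_zero, map_one, map_one]
    exact mul_one (M := RmL m (LaurentPolynomial.C c * LaurentPolynomial.T r)) _
  have hDx := derivation_one_sub_mul_pow_eq_zero
    (A := RmL m (LaurentPolynomial.C c * LaurentPolynomial.T r)) D RmL.isUnit_t
    (RmL.isUnit_u (by omega) hc) (by omega) hn0 hk0 (by omega)
    hkm RmL.u_pow_monomial hat hDt hDu
  refine ⟨D, _, rfl, hDt, ?_, hDx, ?_, ?_, fun y hy => ?_⟩
  · refine hDu.trans (Eq.trans ?_ (RmL.mk_C_C_mul _ _).symm)
    rw [← Nat.cast_pred hr, RmL.mk_C_T_natCast, RmL.const_mul_natCast, mul_assoc]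
  · rw [Ne, Ideal.span_singleton_eq_bot]
    intro h0
    have hω := Complex.isPrimitiveRoot_exp d hd0
    set ω := Complex.exp (2 * Real.pi * Complex.I / d)
    obtain ⟨s, hs⟩ := IsAlgClosed.exists_pow_nat_eq (c' * ω) (Nat.pos_of_ne_zero hn0)
    obtain ⟨f, hf⟩ := hfx s (by
      rw [hn, mul_comm d n, pow_mul, hs, mul_pow, hc', hω.pow_eq_one, mul_one])
    rw [hs, inv_mul_cancel_left₀ hc'0] at hf
    have := hf.symm.trans ((congrArg f h0).trans (map_zero f))
    exact hω.ne_one hd1 (sub_eq_zero.mp this).symm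
  · obtain ⟨s, hs⟩ := IsAlgClosed.exists_pow_nat_eq c' (Nat.pos_of_ne_zero hn0)
    obtain ⟨f, hf⟩ := hfx s (by rw [hn, mul_comm d n, pow_mul, hs, hc'])
    rw [hs, inv_mul_cancel₀ hc'0, sub_self] at hf
    exact span_singleton_ne_top_of_map_eq_zero
      (A := RmL m (LaurentPolynomial.C c * LaurentPolynomial.T r)) f.toRingHom hf
  · exact derivation_mem_span_singleton
      (A := RmL m (LaurentPolynomial.C c * LaurentPolynomial.T r)) D hDx hy
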